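/- Let a, γ, x be nonzero complex numbers with (a;q)_n ≠ 0 for all n ≥ 0. Then, as the real parameter c tends to 0 from above, the big q-Bessel function J_{c·q·γ/a}(x/c;a;q) tends to the little q-Bessel function j_γ(x;a;q). -/

import Mathlib

open Filter Topology

/-- The q-shifted factorial `(a;q)_n = ∏_{j=0}^{n-1} (1 - a q^j)`. -/
noncomputable def qPoch (a q : ℂ) (n : ℕ) : ℂ := ∏ j ∈ Finset.range n, (1 - a * q ^ j)

/-- The big q-Bessel function
`J_γ(x;a;q) = ∑ (-1/x;q)_n (-1)^n q^{n(n-1)/2} / ((a;q)_n (q;q)_n) (aγx)^n`. -/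
noncomputable def bigQBessel (q a γ x : ℂ) : ℂ :=
  ∑' n : ℕ, qPoch (-1 / x) q n * (-1) ^ n * q ^ (n * (n - 1) / 2) /
    (qPoch a q n * qPoch q q n) * (a * γ * x) ^ n

/-- The little q-Bessel (Hahn-Exton q-Bessel) function
`j_γ(x;a;q) = ∑_{n≥0} (-1)^n q^{n(n-1)/2} / ((a;q)_n (q;q)_n) (qγx)^n`. -/
noncomputable def littleQBessel (q a γ x : ℂ) : ℂ :=
  ∑' n : ℕ, (-1) ^ n * q ^ (n * (n - 1) / 2) /
    (qPoch a q n * qPoch q q n) * (q * γ * x) ^ n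

theorem qPoch_succ (a q : ℂ) (n : ℕ) : qPoch a q (n + 1) = qPoch a q n * (1 - a * q ^ n) :=
  Finset.prod_range_succ _ _

theorem qPoch_self_ne_zero {q : ℂ} (hq : ‖q‖ < 1) (n : ℕ) : qPoch q q n ≠ 0 := by
  refine Finset.prod_ne_zero_iff.mpr fun j _ h => ?_
  have h1 : q ^ (j + 1) = 1 := by
    rw [pow_succ']
    exact (sub_eq_zero.mp h).symm
  have h2 : ‖q‖ ^ (j + 1) < 1 := pow_lt_one₀ (norm_nonneg q) hq j.succ_ne_zero
  rw [← norm_pow, h1, norm_one] at h2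
  exact lt_irrefl _ h2

theorem norm_qPoch_le {q : ℂ} (hq : ‖q‖ < 1) (b : ℂ) (n : ℕ) :
    ‖qPoch b q n‖ ≤ Real.exp (‖b‖ * (1 - ‖q‖)⁻¹) := by
  have h1 : ‖qPoch b q n‖ ≤ ∏ j ∈ Finset.range n, Real.exp (‖b‖ * ‖q‖ ^ j) := by
    rw [qPoch, norm_prod]
    refine Finset.prod_le_prod (fun _ _ => norm_nonneg _) fun j _ => ?_
    calc ‖1 - b * q ^ j‖ ≤ ‖(1 : ℂ)‖ + ‖b * q ^ j‖ := norm_sub_le _ _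
      _ = ‖b‖ * ‖q‖ ^ j + 1 := by rw [norm_one, norm_mul, norm_pow, add_comm]
      _ ≤ _ := Real.add_one_le_exp _
  refine h1.trans ?_
  rw [← Real.exp_sum, ← Finset.mul_sum, ← tsum_geometric_of_lt_one (norm_nonneg q) hq]
  gcongr
  exact (summable_geometric_of_lt_one (norm_nonneg q) hq).sum_le_tsum _
    fun _ _ => pow_nonneg (norm_nonneg q) _

theorem tendsto_qPoch_nhds_zero (q : ℂ) (n : ℕ) :
    Tendsto (fun b => qPoch b q n) (𝓝 0) (𝓝 1) := by
  have h : Continuous fun b => qPoch b q n := by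
    unfold qPoch
    fun_prop
  simpa [qPoch] using h.tendsto 0

theorem summable_littleQBessel_term {q a z : ℂ} (hq0 : q ≠ 0) (hq1 : ‖q‖ < 1)
    (haP : ∀ n : ℕ, qPoch a q n ≠ 0) (hz : z ≠ 0) :
    Summable fun n : ℕ => ‖(-1) ^ n * q ^ (n * (n - 1) / 2) /
      (qPoch a q n * qPoch q q n) * z ^ n‖ := by
  set B : ℕ → ℂ := fun n => (-1) ^ n * q ^ (n * (n - 1) / 2) /
      (qPoch a q n * qPoch q q n) * z ^ n with hB
  have hqP := qPoch_self_ne_zero hq1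
  have hB0 : ∀ n, B n ≠ 0 := fun n => by simp [hB, hq0, haP n, hqP n, hz]
  have hratio : ∀ n, B (n + 1) / B n =
      -(q ^ n * z) / ((1 - a * q ^ n) * (1 - q * q ^ n)) := fun n => by
    have h1 := haP (n + 1)
    have h2 := hqP (n + 1)
    rw [qPoch_succ] at h1 h2
    have h3 := right_ne_zero_of_mul h1
    have h4 := right_ne_zero_of_mul h2
    rw [div_eq_iff (hB0 n)]
    simp only [hB]
    rw [qPoch_succ, qPoch_succ, Nat.triangle_succ, pow_add]
    have h5 := haP n
    have h6 := hqP n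
    field_simp
    ring
  have hpow : Tendsto (fun n : ℕ => q ^ n) atTop (𝓝 0) :=
    tendsto_pow_atTop_nhds_zero_of_norm_lt_one hq1
  have hlim : Tendsto (fun n => B (n + 1) / B n) atTop (𝓝 0) := by
    simp only [hratio]
    have hd := ((hpow.const_mul a).const_sub 1).mul ((hpow.const_mul q).const_sub 1)
    have h := (hpow.mul_const z).neg.div hd (by simp)
    simp only [zero_mul, neg_zero, zero_div] at h
    exact h
  refine summable_of_ratio_test_tendsto_lt_one zero_lt_one
    (Eventually.of_forall fun n => norm_ne_zero_iff.mpr (hB0 n)) ?_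
  simpa only [norm_norm, norm_div, norm_zero] using hlim.norm

theorem bigQBessel_to_littleQBessel (q : ℝ) (hq0 : 0 < q) (hq1 : q < 1)
    (a γ x : ℂ) (ha : a ≠ 0) (hγ : γ ≠ 0) (hx : x ≠ 0)
    (haP : ∀ n : ℕ, qPoch a (q : ℂ) n ≠ 0) :
    Tendsto (fun c : ℝ => bigQBessel (q : ℂ) a ((c : ℂ) * (q : ℂ) * γ / a) (x / (c : ℂ)))
      (𝓝[>] (0 : ℝ)) (𝓝 (littleQBessel (q : ℂ) a γ x)) := by
  have hq0' : (q : ℂ) ≠ 0 := Complex.ofReal_ne_zero.mpr hq0.ne'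
  have hq1' : ‖(q : ℂ)‖ < 1 := by rwa [Complex.norm_real, Real.norm_of_nonneg hq0.le]
  have hsum := summable_littleQBessel_term hq0' hq1' haP (mul_ne_zero (mul_ne_zero hq0' hγ) hx)
  have hb : Tendsto (fun c : ℝ => -1 / (x / (c : ℂ))) (𝓝[>] 0) (𝓝 0) := by
    have h : Continuous fun c : ℝ => -(c : ℂ) / x := by fun_prop
    have h0 := (h.tendsto 0).mono_left (nhdsWithin_le_nhds (s := Set.Ioi 0))
    simpa [div_div_eq_mul_div] using h0
  refine tendsto_tsum_of_dominated_convergence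
    (hsum.mul_left (Real.exp (1 * (1 - ‖(q : ℂ)‖)⁻¹))) (fun n => ?_) ?_
  · have h := ((tendsto_qPoch_nhds_zero q n).comp hb).mul_const
      ((-1) ^ n * (q : ℂ) ^ (n * (n - 1) / 2) / (qPoch a q n * qPoch q q n) * (q * γ * x) ^ n)
    rw [one_mul] at h
    refine h.congr' ?_
    filter_upwards [self_mem_nhdsWithin] with c hc
    have hc' : (c : ℂ) ≠ 0 := Complex.ofReal_ne_zero.mpr (ne_of_gt hc)
    have harg : a * (c * q * γ / a) * (x / c) = q * γ * x := by field_simp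
    rw [harg, Function.comp_apply]
    ring
  · have hb1 : ∀ᶠ c : ℝ in 𝓝[>] 0, ‖-1 / (x / (c : ℂ))‖ < 1 :=
      hb.norm.eventually (gt_mem_nhds (by simp))
    filter_upwards [self_mem_nhdsWithin, hb1] with c hc hc1 n
    have hc' : (c : ℂ) ≠ 0 := Complex.ofReal_ne_zero.mpr (ne_of_gt hc)
    have harg : a * (c * q * γ / a) * (x / c) = q * γ * x := by field_simp
    rw [harg, mul_assoc (qPoch _ _ _), mul_div_assoc, mul_assoc (qPoch _ _ _), norm_mul]
    gcongr
    refine (norm_qPoch_le hq1' _ n).trans ?_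
    have : 0 ≤ (1 - ‖(q : ℂ)‖)⁻¹ := inv_nonneg.mpr (sub_nonneg.mpr hq1'.le)
    gcongr
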